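/- For η ∈ V*, η is a Bethe root if and only if (η + σ_η^k)(wφ∨) ∈ 2πℤ for every w ∈ W₀; that is, the Bethe ansatz equations for λ = iη are equivalent to their logarithmic form η(wφ∨) + Σ_{α∈Σ₀} arctan(η(α∨)/k_α)·α(wφ∨) ≡ 0 mod 2πℤ for all w ∈ W₀. -/

import Mathlib

open scoped BigOperators
open RealInnerProductSpace

noncomputable section

/-- The coroot `α∨` of a root `α`, under the identification of `V*` with `V`
via the inner product: `ξ(α∨) = 2⟨ξ,α⟩/‖α‖²`. -/
def coroot {V : Type*} [NormedAddCommGroup V] [InnerProductSpace ℝ V] (α : V) : V :=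
  (2 / ‖α‖ ^ 2) • α

/-- The orthogonal reflection `s_α` in the hyperplane orthogonal to `α`:
`s_α(ξ) = ξ − ξ(α∨)·α = ξ − α(ξ)·α∨`. -/
def sRefl {V : Type*} [NormedAddCommGroup V] [InnerProductSpace ℝ V] (α v : V) : V :=
  v - ⟪α, v⟫ • coroot α

/-- A finite, irreducible, reduced, crystallographic root system `Σ₀` in the dual of
the Euclidean space `V` (identified with `V` via the inner product), together with a
fixed base of simple roots, the positive roots, and the highest root. -/
structure RootSystemBase (V : Type*) [NormedAddCommGroup V] [InnerProductSpace ℝ V]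
    [FiniteDimensional ℝ V] where
  roots : Finset V
  roots_nonempty : roots.Nonempty
  ne_zero : ∀ α ∈ roots, α ≠ (0 : V)
  /-- reduced -/
  reduced : ∀ α ∈ roots, ∀ c : ℝ, c • α ∈ roots → c = 1 ∨ c = -1
  /-- crystallographic: `β(α∨) ∈ ℤ` -/
  crystallographic : ∀ α ∈ roots, ∀ β ∈ roots, ∃ m : ℤ, ⟪β, coroot α⟫ = (m : ℝ)
  /-- stable under the reflections `s_α` -/
  refl_mem : ∀ α ∈ roots, ∀ β ∈ roots, sRefl α β ∈ roots
  /-- `Σ₀` spans `V*` -/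
  spanning : Submodule.span ℝ (roots : Set V) = ⊤
  /-- irreducible: no nontrivial orthogonal decomposition -/
  irreducible : ∀ s : Finset V, s ⊆ roots →
    (∀ α ∈ s, ∀ β ∈ roots, β ∉ s → ⟪α, β⟫ = 0) → s = ∅ ∨ s = roots
  /-- the fixed base of simple roots -/
  simples : Finset V
  simples_sub : simples ⊆ roots
  simples_indep : LinearIndependent ℝ (fun β : {x // x ∈ simples} => (β : V))
  /-- the positive roots w.r.t. the base -/
  pos : Finset V
  pos_sub : pos ⊆ roots
  simples_sub_pos : simples ⊆ pos
  pos_or_neg : ∀ α ∈ roots, (α ∈ pos ∧ -α ∉ pos) ∨ (α ∉ pos ∧ -α ∈ pos)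
  pos_combo : ∀ α ∈ pos, ∃ c : V → ℝ, (∀ β, 0 ≤ c β) ∧ α = ∑ β ∈ simples, c β • β
  /-- the highest root `φ` -/
  hroot : V
  hroot_pos : hroot ∈ pos
  hroot_highest : ∀ α ∈ roots, ∃ c : V → ℝ, (∀ β, 0 ≤ c β) ∧
    hroot - α = ∑ β ∈ simples, c β • β

variable {V : Type*} [NormedAddCommGroup V] [InnerProductSpace ℝ V] [FiniteDimensional ℝ V]

/-- The Weyl group `W₀`: the subgroup of linear automorphisms of `V` generated by the
orthogonal reflections in the roots. -/
def weylGroup (R : RootSystemBase V) : Subgroup (V ≃ₗ[ℝ] V) :=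
  Subgroup.closure {w : V ≃ₗ[ℝ] V | ∃ α ∈ R.roots, ∀ v, w v = sRefl α v}

/-- A strictly positive `W₀`-invariant multiplicity function. -/
def IsMultiplicity (R : RootSystemBase V) (k : V → ℝ) : Prop :=
  (∀ α ∈ R.roots, 0 < k α) ∧
  (∀ w : V ≃ₗ[ℝ] V, w ∈ weylGroup R → ∀ α ∈ R.roots, k (w α) = k α)

/-- `σ_η^k = Σ_{α∈Σ₀} arctan(η(α∨)/k_α)·α`. -/
def sigmaFun (R : RootSystemBase V) (k : V → ℝ) (η : V) : V :=
  ∑ α ∈ R.roots, Real.arctan (⟪η, coroot α⟫ / k α) • α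

/-- The master function
`S_k(μ,ξ) = ½‖ξ‖² − 2π⟨μ,ξ⟩ + ½ Σ_{α∈Σ₀} ‖α‖² ∫₀^{ξ(α∨)} arctan(t/k_α) dt`. -/
def masterFun (R : RootSystemBase V) (k : V → ℝ) (μ ξ : V) : ℝ :=
  ‖ξ‖ ^ 2 / 2 - 2 * Real.pi * ⟪μ, ξ⟫ +
    (1 / 2) * ∑ α ∈ R.roots, ‖α‖ ^ 2 * ∫ t in (0:ℝ)..(⟪ξ, coroot α⟫), Real.arctan (t / k α)

/-- Membership in the weight lattice `P = {λ ∈ V* : λ(α∨) ∈ ℤ ∀α ∈ Σ₀}`. -/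
def IsWeight (R : RootSystemBase V) (lam : V) : Prop :=
  ∀ α ∈ R.roots, ∃ m : ℤ, ⟪lam, coroot α⟫ = (m : ℝ)

/-- `η ∈ V*` is a Bethe root: `λ = iη` solves the Bethe ansatz equations
`e^{(wλ)(φ∨)} = ∏_{α∈Σ₀⁺} ((wλ)(α∨) − k_α)/((wλ)(α∨) + k_α))^{α(φ∨)}` for all `w ∈ W₀`,
where `m α = α(φ∨) ∈ ℤ≥0`. -/
def IsBetheRoot (R : RootSystemBase V) (k : V → ℝ) (m : V → ℕ) (η : V) : Prop :=
  ∀ w : V ≃ₗ[ℝ] V, w ∈ weylGroup R →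
    Complex.exp (Complex.I * (⟪w η, coroot R.hroot⟫ : ℝ)) =
      ∏ α ∈ R.pos,
        ((Complex.I * (⟪w η, coroot α⟫ : ℝ) - (k α : ℂ)) /
         (Complex.I * (⟪w η, coroot α⟫ : ℝ) + (k α : ℂ))) ^ (m α)

end

noncomputable section

section helpers

variable {V : Type*} [NormedAddCommGroup V] [InnerProductSpace ℝ V]

theorem sRefl_eq_reflection [FiniteDimensional ℝ V] (α v : V) :
    sRefl α v = (ℝ ∙ α)ᗮ.reflection v := by
  rw [Submodule.reflection_orthogonal_apply, Submodule.reflection_singleton_apply, sRefl, coroot]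
  rw [neg_sub, smul_smul, two_smul, ← add_smul]
  congr 2
  simp
  ring

theorem coroot_neg (α : V) : coroot (-α) = -coroot α := by
  simp [coroot]

theorem inner_self_coroot {α : V} (hα : α ≠ 0) : ⟪α, coroot α⟫ = 2 := by
  have : ‖α‖ ≠ 0 := by simpa using hα
  rw [coroot, inner_smul_right, real_inner_self_eq_norm_sq]
  field_simp

theorem inner_smul_self_coroot (α β : V) : ⟪α, β⟫ • coroot α = ⟪β, coroot α⟫ • α := by
  rw [coroot, inner_smul_right, smul_smul, real_inner_comm, mul_comm]

theorem coroot_map (w : V ≃ₗ[ℝ] V) (hw : ∀ v, ‖w v‖ = ‖v‖) (α : V) :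
    coroot (w α) = w (coroot α) := by
  simp [coroot, hw]

theorem inner_map_map_of_norm_map (w : V ≃ₗ[ℝ] V) (hw : ∀ v, ‖w v‖ = ‖v‖) (x y : V) :
    ⟪w x, w y⟫ = ⟪x, y⟫ :=
  (LinearIsometryEquiv.mk w hw).inner_map_map x y

variable [FiniteDimensional ℝ V]

theorem norm_map_of_mem_weylGroup (R : RootSystemBase V) {w : V ≃ₗ[ℝ] V}
    (hw : w ∈ weylGroup R) : ∀ v, ‖w v‖ = ‖v‖ := by
  induction hw using Subgroup.closure_induction with
  | mem w h =>
    obtain ⟨α, -, h⟩ := h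
    intro v
    rw [h, sRefl_eq_reflection, LinearIsometryEquiv.norm_map]
  | one => simp
  | mul a b _ _ ha hb => intro v; rw [LinearEquiv.mul_apply, ha, hb]
  | inv a _ ha =>
    intro v
    rw [← ha]
    congr 1
    exact a.apply_symm_apply v

theorem weylGroup_map_mem_roots (R : RootSystemBase V) {w : V ≃ₗ[ℝ] V}
    (hw : w ∈ weylGroup R) : ∀ β ∈ R.roots, w β ∈ R.roots := by
  induction hw using Subgroup.closure_induction with
  | mem w h =>
    obtain ⟨α, hα, h⟩ := h
    intro v hv
    rw [h]
    exact R.refl_mem α hα v hv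
  | one => simp
  | mul a b _ _ ha hb => intro v hv; exact ha _ (hb _ hv)
  | inv a _ ha =>
    intro v hv
    obtain ⟨u, hu, huv⟩ := Finset.surj_on_of_inj_on_of_card_le (s := R.roots) (t := R.roots)
      (fun x _ => a x) ha (fun _ _ _ _ h => a.injective h) le_rfl v hv
    have : a⁻¹ v = u := by
      rw [huv]
      exact a.symm_apply_apply u
    rwa [this]

theorem neg_mem_roots (R : RootSystemBase V) {α : V} (hα : α ∈ R.roots) : -α ∈ R.roots := by
  rcases R.pos_or_neg α hα with h | h
  · have := R.refl_mem α hα α hα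
    rwa [sRefl, inner_smul_self_coroot, inner_self_coroot (R.ne_zero α hα), two_smul,
      sub_add_cancel_left] at this
  · exact R.pos_sub h.2

theorem IsMultiplicity.apply_neg {R : RootSystemBase V} {k : V → ℝ} (hk : IsMultiplicity R k) {α : V}
    (hα : α ∈ R.roots) : k (-α) = k α := by
  have h := hk.2 ((ℝ ∙ α)ᗮ.reflection).toLinearEquiv
    (Subgroup.subset_closure ⟨α, hα, fun v => (sRefl_eq_reflection α v).symm⟩) α hα
  rwa [LinearIsometryEquiv.coe_toLinearEquiv, ← sRefl_eq_reflection, sRefl,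
    inner_smul_self_coroot, inner_self_coroot (R.ne_zero α hα), two_smul,
    sub_add_cancel_left] at h

theorem sigmaFun_weylGroup {R : RootSystemBase V} {k : V → ℝ} (hk : IsMultiplicity R k)
    {w : V ≃ₗ[ℝ] V} (hw : w ∈ weylGroup R) (η : V) :
    sigmaFun R k (w η) = w (sigmaFun R k η) := by
  have hn := norm_map_of_mem_weylGroup R hw
  rw [sigmaFun, sigmaFun, map_sum]
  symm
  refine Finset.sum_bij (fun α _ => w α) (weylGroup_map_mem_roots R hw)
    (fun _ _ _ _ h => w.injective h) (fun β hβ => ?_) (fun α hα => ?_)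
  · exact ⟨w⁻¹ β, weylGroup_map_mem_roots R (inv_mem hw) β hβ, w.apply_symm_apply β⟩
  · rw [map_smul, hk.2 w hw α hα, coroot_map w hn, inner_map_map_of_norm_map w hn]

theorem sum_roots_eq_two_mul_sum_pos (R : RootSystemBase V) (f : V → ℝ)
    (hf : ∀ α ∈ R.roots, f (-α) = f α) :
    ∑ α ∈ R.roots, f α = 2 * ∑ α ∈ R.pos, f α := by
  classical
  rw [← Finset.sum_sdiff R.pos_sub, two_mul]
  congr 1
  refine Finset.sum_bij (fun α _ => -α) (fun α hα => ?_) (fun _ _ _ _ h => neg_injective h)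
    (fun β hβ => ?_) (fun α hα => ?_)
  · rw [Finset.mem_sdiff] at hα
    rcases R.pos_or_neg α hα.1 with h | h
    · exact absurd h.1 hα.2
    · exact h.2
  · have hβ' := R.pos_sub hβ
    refine ⟨-β, ?_, neg_neg β⟩
    rw [Finset.mem_sdiff]
    refine ⟨neg_mem_roots R hβ', ?_⟩
    rcases R.pos_or_neg β hβ' with h | h
    · exact h.2
    · exact absurd hβ h.1
  · exact (hf α (Finset.mem_sdiff.mp hα).1).symm

theorem mem_pos_of_nonneg_combo (R : RootSystemBase V) {γ : V} (hγ : γ ∈ R.roots) (c : V → ℝ)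
    (hc : ∀ β, 0 ≤ c β) (hγc : γ = ∑ β ∈ R.simples, c β • β) : γ ∈ R.pos := by
  rcases R.pos_or_neg γ hγ with h | h
  · exact h.1
  · obtain ⟨d, hd, hγd⟩ := R.pos_combo _ h.2
    have hsum : ∑ β ∈ R.simples, (c β + d β) • β = 0 := by
      simp_rw [add_smul]
      rw [Finset.sum_add_distrib, ← hγc, ← hγd, add_neg_cancel]
    have hli := Fintype.linearIndependent_iff.mp R.simples_indep (fun β => c β + d β)
      (by rw [← hsum]; exact Finset.sum_coe_sort R.simples fun β => (c β + d β) • β)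
    refine absurd ?_ (R.ne_zero γ hγ)
    rw [hγc]
    refine Finset.sum_eq_zero fun β hβ => ?_
    have h1 := hli ⟨β, hβ⟩
    have h2 : c β = 0 := by linarith [hc β, hd β]
    rw [h2, zero_smul]

/-- The reflected root `-s_φ(β) = β(φ∨)φ - β` is again positive when `β(φ∨) ≥ 1`. -/
theorem smul_hroot_sub_mem_pos (R : RootSystemBase V) {β : V} (hβ : β ∈ R.pos)
    (h1 : 1 ≤ ⟪β, coroot R.hroot⟫) : ⟪β, coroot R.hroot⟫ • R.hroot - β ∈ R.pos := by
  have hβ' := R.pos_sub hβ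
  have hmem := neg_mem_roots R (R.refl_mem _ (R.pos_sub R.hroot_pos) β hβ')
  rw [sRefl, inner_smul_self_coroot, neg_sub] at hmem
  obtain ⟨c, hc, hc'⟩ := R.hroot_highest β hβ'
  obtain ⟨d, hd, hd'⟩ := R.pos_combo _ R.hroot_pos
  set t := ⟪β, coroot R.hroot⟫
  refine mem_pos_of_nonneg_combo R hmem (fun γ => (t - 1) * d γ + c γ)
    (fun γ => add_nonneg (mul_nonneg (by linarith) (hd γ)) (hc γ)) ?_
  simp_rw [add_smul, mul_smul]
  rw [Finset.sum_add_distrib, ← Finset.smul_sum, ← hc', ← hd', sub_smul, one_smul]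
  abel

/-- `2ρ(φ∨)` is even. -/
theorem even_sum_pos_hroot (R : RootSystemBase V) (m : V → ℕ)
    (hm : ∀ α ∈ R.pos, ⟪α, coroot R.hroot⟫ = (m α : ℝ)) : Even (∑ α ∈ R.pos, m α) := by
  classical
  have hφ := R.ne_zero _ (R.pos_sub R.hroot_pos)
  have hpair : ∀ (t : ℝ) (β : V), ⟪t • R.hroot - β, coroot R.hroot⟫
      = 2 * t - ⟪β, coroot R.hroot⟫ := by
    intro t β
    rw [inner_sub_left, real_inner_smul_left, inner_self_coroot hφ, mul_comm]
  rw [← ZMod.natCast_eq_zero_iff_even, Nat.cast_sum,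
    ← Finset.sum_filter_of_ne (p := fun α => m α ≠ 0)
      (fun α _ h h0 => h (by rw [h0, Nat.cast_zero]))]
  have hmap : ∀ β ∈ R.pos, m β ≠ 0 →
      (m β : ℝ) • R.hroot - β ∈ R.pos ∧ m ((m β : ℝ) • R.hroot - β) = m β := by
    intro β hβ h0
    have h1 : (m β : ℝ) • R.hroot - β ∈ R.pos := by
      have := smul_hroot_sub_mem_pos R hβ
        (by rw [hm β hβ]; exact_mod_cast Nat.one_le_iff_ne_zero.mpr h0)
      rwa [hm β hβ] at this
    refine ⟨h1, ?_⟩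
    have h2 := hpair (m β) β
    rw [hm _ h1, hm β hβ] at h2
    exact_mod_cast (by linarith : (m ((m β : ℝ) • R.hroot - β) : ℝ) = m β)
  refine Finset.sum_involution (fun β _ => (m β : ℝ) • R.hroot - β) ?_ ?_ ?_ ?_
  · intro β hβ
    rw [Finset.mem_filter] at hβ
    rw [(hmap β hβ.1 hβ.2).2]
    exact CharTwo.add_self_eq_zero _
  · intro β hβ hodd heq
    rw [Finset.mem_filter] at hβ
    have h2 : β = ((m β : ℝ) / 2) • R.hroot := by
      have h3 : (m β : ℝ) • R.hroot = (2 : ℝ) • β := by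
        rw [two_smul]; exact sub_eq_iff_eq_add.mp heq
      rw [div_eq_inv_mul, mul_smul, h3, smul_smul]
      norm_num
    have h4 := R.reduced _ (R.pos_sub R.hroot_pos) ((m β : ℝ) / 2)
      (by rw [← h2]; exact R.pos_sub hβ.1)
    have h5 : m β = 2 := by
      rcases h4 with h | h
      · exact_mod_cast (by linarith : (m β : ℝ) = 2)
      · have : (0 : ℝ) ≤ m β := Nat.cast_nonneg _
        linarith
    rw [h5] at hodd
    exact hodd rfl
  · intro β hβ
    rw [Finset.mem_filter] at hβ ⊢
    have := hmap β hβ.1 hβ.2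
    exact ⟨this.1, by rw [this.2]; exact hβ.2⟩
  · intro β hβ
    rw [Finset.mem_filter] at hβ
    rw [(hmap β hβ.1 hβ.2).2, sub_sub_cancel]

theorem cayley_eq_neg_exp_arctan (x : ℝ) {k : ℝ} (hk : 0 < k) :
    (Complex.I * (x : ℂ) - (k : ℂ)) / (Complex.I * (x : ℂ) + (k : ℂ)) =
      -Complex.exp (-(2 * Complex.I * (Real.arctan (x / k) : ℂ))) := by
  set θ := Real.arctan (x / k) with hθ
  have hc : 0 < Real.cos θ := Real.cos_arctan_pos _
  have hx : x * Real.cos θ = k * Real.sin θ := by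
    have h := Real.tan_arctan (x / k)
    rw [← hθ, Real.tan_eq_sin_div_cos] at h
    field_simp at h
    linarith
  have hxC : (x : ℂ) * Complex.cos θ = k * Complex.sin θ := by exact_mod_cast hx
  have hcC : Complex.cos θ ≠ 0 := by exact_mod_cast hc.ne'
  have hkC : (k : ℂ) ≠ 0 := by exact_mod_cast hk.ne'
  have hp : (Complex.I * (x : ℂ) + k) * Complex.cos θ = k * Complex.exp (θ * Complex.I) := by
    rw [Complex.exp_mul_I]; linear_combination Complex.I * hxC
  have hm : (Complex.I * (x : ℂ) - k) * Complex.cos θ = -(k * Complex.exp (-θ * Complex.I)) := by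
    rw [Complex.exp_mul_I, Complex.cos_neg, Complex.sin_neg]; linear_combination Complex.I * hxC
  rw [← mul_div_mul_right _ _ hcC, hp, hm, neg_div, mul_div_mul_left _ _ hkC, ← Complex.exp_sub]
  congr 2
  ring

theorem inner_sigmaFun_hroot {R : RootSystemBase V} {k : V → ℝ} (hk : IsMultiplicity R k)
    (m : V → ℕ) (hm : ∀ α ∈ R.pos, ⟪α, coroot R.hroot⟫ = (m α : ℝ)) (ξ : V) :
    ⟪sigmaFun R k ξ, coroot R.hroot⟫ =
      2 * ∑ α ∈ R.pos, Real.arctan (⟪ξ, coroot α⟫ / k α) * m α := by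
  rw [sigmaFun, sum_inner]
  simp_rw [real_inner_smul_left]
  rw [sum_roots_eq_two_mul_sum_pos R
    (fun α => Real.arctan (⟪ξ, coroot α⟫ / k α) * ⟪α, coroot R.hroot⟫)]
  · congr 1
    exact Finset.sum_congr rfl fun α hα => by rw [hm α hα]
  · intro α hα
    simp only [IsMultiplicity.apply_neg hk hα, coroot_neg, inner_neg_right, inner_neg_left, neg_div,
      Real.arctan_neg, neg_mul_neg]

theorem prod_cayley_eq_exp {R : RootSystemBase V} {k : V → ℝ} (hk : IsMultiplicity R k)
    (m : V → ℕ) (hm : ∀ α ∈ R.pos, ⟪α, coroot R.hroot⟫ = (m α : ℝ)) (ξ : V) :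
    ∏ α ∈ R.pos,
        ((Complex.I * (⟪ξ, coroot α⟫ : ℝ) - (k α : ℂ)) /
         (Complex.I * (⟪ξ, coroot α⟫ : ℝ) + (k α : ℂ))) ^ (m α) =
      Complex.exp (-(Complex.I * (⟪sigmaFun R k ξ, coroot R.hroot⟫ : ℝ))) := by
  rw [inner_sigmaFun_hroot hk m hm]
  have h : ∀ α ∈ R.pos, ((Complex.I * (⟪ξ, coroot α⟫ : ℝ) - (k α : ℂ)) /
         (Complex.I * (⟪ξ, coroot α⟫ : ℝ) + (k α : ℂ))) ^ (m α) =
      (-1) ^ m α * Complex.exp (m α *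
        (-(2 * Complex.I * (Real.arctan (⟪ξ, coroot α⟫ / k α) : ℂ)))) := by
    intro α hα
    rw [cayley_eq_neg_exp_arctan _ (hk.1 α (R.pos_sub hα)), neg_pow, Complex.exp_nat_mul]
  rw [Finset.prod_congr rfl h, Finset.prod_mul_distrib, Finset.prod_pow_eq_pow_sum,
    (even_sum_pos_hroot R m hm).neg_one_pow, one_mul, ← Complex.exp_sum]
  congr 1
  push_cast
  rw [Finset.mul_sum, Finset.mul_sum, ← Finset.sum_neg_distrib]
  exact Finset.sum_congr rfl fun α _ => by ring

theorem exp_I_mul_eq_one_iff (x : ℝ) :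
    Complex.exp (Complex.I * (x : ℂ)) = 1 ↔ ∃ j : ℤ, x = 2 * Real.pi * (j : ℝ) := by
  rw [Complex.exp_eq_one_iff]
  refine exists_congr fun j => ?_
  rw [show (j : ℂ) * (2 * Real.pi * Complex.I) = Complex.I * ((2 * Real.pi * j : ℝ) : ℂ) by
    push_cast; ring, mul_right_inj' Complex.I_ne_zero, Complex.ofReal_inj]

theorem betheEquation_iff {R : RootSystemBase V} {k : V → ℝ} (hk : IsMultiplicity R k)
    (m : V → ℕ) (hm : ∀ α ∈ R.pos, ⟪α, coroot R.hroot⟫ = (m α : ℝ)) (η : V)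
    {w : V ≃ₗ[ℝ] V} (hw : w ∈ weylGroup R) :
    (Complex.exp (Complex.I * (⟪w η, coroot R.hroot⟫ : ℝ)) =
      ∏ α ∈ R.pos,
        ((Complex.I * (⟪w η, coroot α⟫ : ℝ) - (k α : ℂ)) /
         (Complex.I * (⟪w η, coroot α⟫ : ℝ) + (k α : ℂ))) ^ (m α)) ↔
      ∃ j : ℤ, ⟪η + sigmaFun R k η, w⁻¹ (coroot R.hroot)⟫ = 2 * Real.pi * (j : ℝ) := by
  rw [prod_cayley_eq_exp hk m hm, ← exp_I_mul_eq_one_iff, Complex.exp_neg,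
    ← mul_eq_one_iff_eq_inv₀ (Complex.exp_ne_zero _), ← Complex.exp_add, ← mul_add,
    ← Complex.ofReal_add, ← inner_add_left, sigmaFun_weylGroup hk hw, ← map_add]
  have h : ⟪η + sigmaFun R k η, w⁻¹ (coroot R.hroot)⟫ =
      ⟪w (η + sigmaFun R k η), coroot R.hroot⟫ := by
    rw [← inner_map_map_of_norm_map w (norm_map_of_mem_weylGroup R hw)]
    congr 1
    exact w.apply_symm_apply _
  rw [h]

end helpers

/-- `η ∈ V*` is a Bethe root iff `(η + σ_η^k)(wφ∨) ∈ 2πℤ` for every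
`w ∈ W₀` (the logarithmic form of the Bethe ansatz equations). -/
theorem statement4
    {V : Type*} [NormedAddCommGroup V] [InnerProductSpace ℝ V] [FiniteDimensional ℝ V]
    (R : RootSystemBase V) (k : V → ℝ) (hk : IsMultiplicity R k)
    (m : V → ℕ) (hm : ∀ α ∈ R.pos, ⟪α, coroot R.hroot⟫ = (m α : ℝ))
    (η : V) :
    IsBetheRoot R k m η ↔
      ∀ w : V ≃ₗ[ℝ] V, w ∈ weylGroup R →
        ∃ j : ℤ, ⟪η + sigmaFun R k η, w (coroot R.hroot)⟫ = 2 * Real.pi * (j : ℝ) := by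
  constructor
  · intro h w hw
    have := (betheEquation_iff hk m hm η (inv_mem hw)).mp (h _ (inv_mem hw))
    rwa [inv_inv] at this
  · exact fun h w hw => (betheEquation_iff hk m hm η hw).mpr (h _ (inv_mem hw))

end
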